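/- Let R > 0, r ∈ (0, R), k ≥ 1, and let ζ : B_{R,r} → ℝ^k be a smooth function with ∫_{B_{R,r}} ζ = 0 and ‖dζ‖₂ < ∞. Then ( ∫₀^{2π} | ∫_r^R ζ(ρ cos θ, ρ sin θ) ρ dρ | dθ )² ≤ (π R⁴ / 2) · ‖dζ‖₂², where the inner |·| is the Euclidean norm on ℝ^k. -/

import Mathlib

open MeasureTheory Real

/-- The open annulus `B_{R,r} = B_R \ closure(B_r)` in the Euclidean plane. -/
noncomputable def annulus (R r : ℝ) : Set (EuclideanSpace ℝ (Fin 2)) :=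
  Metric.ball 0 R \ closure (Metric.ball 0 r)

/-- The point of the plane with polar coordinates `(ρ, θ)`. -/
noncomputable def polarPt (ρ θ : ℝ) : EuclideanSpace ℝ (Fin 2) :=
  (WithLp.equiv 2 (Fin 2 → ℝ)).symm ![ρ * Real.cos θ, ρ * Real.sin θ]

/-- **Wirtinger's inequality** for complex-valued functions on an interval. -/
theorem integral_sq_norm_le_of_periodic_of_integral_eq_zero {a b : ℝ} (hab : a < b) {f f' : ℝ → ℂ}
    (hf : ∀ x, HasDerivAt f (f' x) x) (hf' : Continuous f') (hper : f b = f a)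
    (hmean : ∫ x in a..b, f x = 0) :
    ∫ x in a..b, ‖f x‖ ^ 2 ≤ ((b - a) / (2 * π)) ^ 2 * ∫ x in a..b, ‖f' x‖ ^ 2 := by
  have hba : 0 < b - a := sub_pos.2 hab
  have hfc : Continuous f := continuous_iff_continuousAt.2 fun x => (hf x).continuousAt
  have memLp_of_continuous : ∀ g : ℝ → ℂ, Continuous g →
      MemLp g 2 (volume.restrict (Set.Ioc a b)) := by
    intro g hg
    rw [memLp_two_iff_integrable_sq_norm hg.aestronglyMeasurable]
    exact (hg.norm.pow 2).integrableOn_Ioc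
  have hF := hasSum_sq_fourierCoeffOn hab (memLp_of_continuous f hfc)
  have hF' := (hasSum_sq_fourierCoeffOn hab (memLp_of_continuous f' hf')).mul_left
    (((b - a) / (2 * π)) ^ 2)
  have key : ∀ n : ℤ, ‖fourierCoeffOn hab f n‖ ^ 2 ≤
      ((b - a) / (2 * π)) ^ 2 * ‖fourierCoeffOn hab f' n‖ ^ 2 := by
    intro n
    by_cases hn : n = 0
    · subst hn
      have : fourierCoeffOn hab f 0 = 0 := by
        rw [fourierCoeffOn_eq_integral]
        simp [hmean]
      rw [this]
      simp only [norm_zero, ne_eq, OfNat.ofNat_ne_zero, not_false_eq_true, zero_pow]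
      positivity
    · rw [fourierCoeffOn_of_hasDerivAt hab hn (fun x _ => hf x) (hf'.intervalIntegrable _ _), hper]
      have h1 : (1 : ℝ) ≤ |(n : ℝ)| := by
        exact_mod_cast Int.one_le_abs hn
      have h2 : ‖((b : ℂ) - a)‖ = b - a := by
        rw [← Complex.ofReal_sub, Complex.norm_real, Real.norm_of_nonneg hba.le]
      rw [← mul_pow]
      refine pow_le_pow_left₀ (norm_nonneg _) ?_ 2
      simp only [sub_self, mul_zero, zero_sub, norm_mul, norm_neg, norm_div, h2, norm_one,
        Complex.norm_I, Complex.norm_real, Complex.norm_intCast, Real.norm_eq_abs,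
        abs_of_pos Real.pi_pos, Complex.norm_ofNat, mul_one]
      have h3 : 1 / (2 * π * |(n : ℝ)|) ≤ 1 / (2 * π) := by
        apply one_div_le_one_div_of_le (by positivity)
        nlinarith [Real.pi_pos]
      calc _ ≤ 1 / (2 * π) * ((b - a) * ‖fourierCoeffOn hab f' n‖) := by gcongr
        _ = _ := by ring
  have := hasSum_le key hF hF'
  simp only [smul_eq_mul] at this
  rw [mul_left_comm] at this
  exact le_of_mul_le_mul_left this (inv_pos.2 hba)

/-- **Wirtinger's inequality** for vector-valued `2π`-periodic functions. -/
theorem EuclideanSpace.integral_sq_norm_sub_average_le {ι : Type*} [Fintype ι]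
    {f f' : ℝ → EuclideanSpace ℝ ι}
    (hf : ∀ x, HasDerivAt f (f' x) x) (hf' : Continuous f') (hper : f π = f (-π)) :
    ∫ x in (-π)..π, ‖f x - (2 * π)⁻¹ • ∫ t in (-π)..π, f t‖ ^ 2 ≤
      ∫ x in (-π)..π, ‖f' x‖ ^ 2 := by
  have hfc : Continuous f := continuous_iff_continuousAt.2 fun x => (hf x).continuousAt
  set m := (2 * π)⁻¹ • ∫ t in (-π)..π, f t with hm
  have hcoord : ∀ i, m i = (2 * π)⁻¹ * ∫ t in (-π)..π, f t i := by
    intro i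
    rw [hm, PiLp.smul_apply, smul_eq_mul]
    congr 1
    exact ((EuclideanSpace.proj (𝕜 := ℝ) i).intervalIntegral_comp_comm
      (hfc.intervalIntegrable _ _)).symm
  have hci : ∀ i, Continuous fun x => f x i := fun i => by fun_prop
  have hci' : ∀ i, Continuous fun x => f' x i := fun i => by fun_prop
  have hi : ∀ i, ∫ x in (-π)..π, ((f x - m) i) ^ 2 ≤ ∫ x in (-π)..π, (f' x i) ^ 2 := by
    intro i
    have h := integral_sq_norm_le_of_periodic_of_integral_eq_zero (a := -π) (b := π)
      (by linarith [Real.pi_pos]) (f := fun x => (((f x - m) i : ℝ) : ℂ))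
      (f' := fun x => ((f' x i : ℝ) : ℂ)) (fun x => ?_) (by fun_prop) (by simp [hper]) ?_
    · have h1 : (π - -π) / (2 * π) = 1 := by
        field_simp; ring
      simp only [h1, Complex.norm_real, Real.norm_eq_abs, sq_abs, one_pow, one_mul] at h
      exact h
    · have := (hf x).sub_const m
      exact (((EuclideanSpace.proj (𝕜 := ℝ) i).hasFDerivAt.comp_hasDerivAt x this)).ofReal_comp
    · rw [intervalIntegral.integral_ofReal]
      simp only [PiLp.sub_apply, Complex.ofReal_eq_zero]
      rw [intervalIntegral.integral_sub ((hci i).intervalIntegrable _ _) (by simp),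
        intervalIntegral.integral_const, hcoord, smul_eq_mul]
      field_simp
      ring
  simp only [EuclideanSpace.real_norm_sq_eq]
  rw [intervalIntegral.integral_finsetSum, intervalIntegral.integral_finsetSum]
  · exact Finset.sum_le_sum fun i _ => hi i
  · exact fun i _ => ((hci' i).pow 2).intervalIntegrable _ _
  · intro i _
    apply Continuous.intervalIntegrable
    fun_prop
theorem annulus_eq {r : ℝ} (hr : 0 < r) (R : ℝ) : annulus R r = {y | ‖y‖ ∈ Set.Ioo r R} := by
  ext y
  simp [annulus, closure_ball _ hr.ne', and_comm]

theorem isOpen_annulus (R r : ℝ) : IsOpen (annulus R r) :=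
  Metric.isOpen_ball.sdiff isClosed_closure

theorem norm_polarPt {ρ : ℝ} (hρ : 0 ≤ ρ) (θ : ℝ) : ‖polarPt ρ θ‖ = ρ := by
  rw [EuclideanSpace.norm_eq, Real.sqrt_eq_iff_mul_self_eq (by positivity) hρ]
  simp [polarPt, Fin.sum_univ_two]
  linear_combination ρ ^ 2 * Real.sin_sq_add_cos_sq θ

/-- The plane as a product of two lines. -/
noncomputable def planeEquiv : ℝ × ℝ ≃ᵐ EuclideanSpace ℝ (Fin 2) :=
  MeasurableEquiv.finTwoArrow.symm.trans (MeasurableEquiv.toLp 2 (Fin 2 → ℝ))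

theorem measurePreserving_planeEquiv : MeasurePreserving planeEquiv :=
  (PiLp.volume_preserving_toLp (Fin 2)).comp (volume_preserving_finTwoArrow ℝ).symm

theorem planeEquiv_polarCoord_symm (p : ℝ × ℝ) :
    planeEquiv (polarCoord.symm p) = polarPt p.1 p.2 := rfl

theorem polarPt_mem_annulus_iff {R r : ℝ} (hr : 0 < r) {ρ : ℝ} (hρ : 0 ≤ ρ) (θ : ℝ) :
    polarPt ρ θ ∈ annulus R r ↔ ρ ∈ Set.Ioo r R := by
  rw [annulus_eq hr, Set.mem_ofPred_eq, norm_polarPt hρ]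

theorem setLIntegral_annulus {R r : ℝ} (hr : 0 < r) (F : EuclideanSpace ℝ (Fin 2) → ENNReal) :
    ∫⁻ y in annulus R r, F y =
      ∫⁻ p in Set.Ioo r R ×ˢ Set.Ioo (-π) π, ENNReal.ofReal p.1 * F (polarPt p.1 p.2) := by
  rw [← lintegral_indicator (isOpen_annulus R r).measurableSet,
    ← measurePreserving_planeEquiv.lintegral_comp_emb planeEquiv.measurableEmbedding,
    ← lintegral_comp_polarCoord_symm,
    ← lintegral_indicator (measurableSet_Ioo.prod measurableSet_Ioo),
    ← lintegral_indicator polarCoord.open_target.measurableSet]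
  congr 1 with p
  by_cases h1 : p ∈ polarCoord.target
  · have hp : 0 ≤ p.1 := le_of_lt h1.1
    rw [Set.indicator_of_mem h1, planeEquiv_polarCoord_symm]
    by_cases h2 : p.1 ∈ Set.Ioo r R
    · rw [Set.indicator_of_mem ((polarPt_mem_annulus_iff hr hp _).2 h2),
        Set.indicator_of_mem (Set.mk_mem_prod h2 h1.2), smul_eq_mul]
    · rw [Set.indicator_of_notMem (mt (polarPt_mem_annulus_iff hr hp _).1 h2),
        Set.indicator_of_notMem (fun h => h2 h.1), smul_zero]
  · rw [Set.indicator_of_notMem h1, Set.indicator_of_notMem]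
    exact fun h => h1 ⟨hr.trans h.1.1, h.2⟩

theorem setIntegral_annulus {E : Type*} [NormedAddCommGroup E] [NormedSpace ℝ E] {R r : ℝ}
    (hr : 0 < r) (F : EuclideanSpace ℝ (Fin 2) → E) :
    ∫ y in annulus R r, F y =
      ∫ p in Set.Ioo r R ×ˢ Set.Ioo (-π) π, p.1 • F (polarPt p.1 p.2) := by
  rw [← integral_indicator (isOpen_annulus R r).measurableSet,
    ← measurePreserving_planeEquiv.integral_comp planeEquiv.measurableEmbedding,
    ← integral_comp_polarCoord_symm,
    ← integral_indicator (measurableSet_Ioo.prod measurableSet_Ioo),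
    ← integral_indicator polarCoord.open_target.measurableSet]
  congr 1 with p
  by_cases h1 : p ∈ polarCoord.target
  · have hp : 0 ≤ p.1 := le_of_lt h1.1
    rw [Set.indicator_of_mem h1, planeEquiv_polarCoord_symm]
    by_cases h2 : p.1 ∈ Set.Ioo r R
    · rw [Set.indicator_of_mem ((polarPt_mem_annulus_iff hr hp _).2 h2),
        Set.indicator_of_mem (Set.mk_mem_prod h2 h1.2)]
    · rw [Set.indicator_of_notMem (mt (polarPt_mem_annulus_iff hr hp _).1 h2),
        Set.indicator_of_notMem (fun h => h2 h.1), smul_zero]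
  · rw [Set.indicator_of_notMem h1, Set.indicator_of_notMem]
    exact fun h => h1 ⟨hr.trans h.1.1, h.2⟩

theorem hasDerivAt_polarPt (ρ θ : ℝ) :
    HasDerivAt (polarPt ρ) (ρ • polarPt 1 (θ + π / 2)) θ := by
  have h : HasDerivAt (fun t => ![ρ * Real.cos t, ρ * Real.sin t])
      (ρ • ![1 * Real.cos (θ + π / 2), 1 * Real.sin (θ + π / 2)]) θ := by
    refine hasDerivAt_pi.2 fun i => ?_
    fin_cases i
    · simpa [Real.cos_add_pi_div_two] using (Real.hasDerivAt_cos θ).const_mul ρ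
    · simpa [Real.sin_add_pi_div_two] using (Real.hasDerivAt_sin θ).const_mul ρ
  exact (PiLp.continuousLinearEquiv 2 ℝ fun _ : Fin 2 => ℝ).symm.hasFDerivAt.comp_hasDerivAt θ h

theorem continuous_polarPt : Continuous fun p : ℝ × ℝ => polarPt p.1 p.2 := by
  refine (PiLp.continuous_toLp 2 _).comp (continuous_pi fun i => ?_)
  fin_cases i <;> simp <;> fun_prop

theorem polarPt_add_two_pi (ρ θ : ℝ) : polarPt ρ (θ + 2 * π) = polarPt ρ θ := by
  simp [polarPt]

theorem ENNReal.lintegral_mul_sq_le {α : Type*} [MeasurableSpace α] {μ : Measure α}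
    {f g : α → ENNReal} (hf : AEMeasurable f μ) (hg : AEMeasurable g μ) :
    (∫⁻ x, f x * g x ∂μ) ^ 2 ≤ (∫⁻ x, f x ^ 2 ∂μ) * ∫⁻ x, g x ^ 2 ∂μ := by
  have h := ENNReal.lintegral_mul_le_Lp_mul_Lq μ Real.HolderConjugate.two_two hf hg
  have h2 : ∀ x : ENNReal, (x ^ (1 / 2 : ℝ)) ^ 2 = x := fun x => by
    rw [← ENNReal.rpow_natCast, ← ENNReal.rpow_mul]; norm_num
  refine (pow_le_pow_left' h 2).trans_eq ?_
  simp only [mul_pow, h2, ENNReal.rpow_two]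

theorem lintegral_sq_enorm_sub_circleAverage_le {ι : Type*} [Fintype ι]
    {U : Set (EuclideanSpace ℝ (Fin 2))}
    (hU : IsOpen U) {ζ : EuclideanSpace ℝ (Fin 2) → EuclideanSpace ℝ ι} (hζ : ContDiffOn ℝ 1 ζ U)
    {ρ : ℝ} (hρ : 0 ≤ ρ) (hmem : ∀ θ, polarPt ρ θ ∈ U) :
    ∫⁻ θ in Set.Ioo (-π) π,
        ‖ζ (polarPt ρ θ) - (2 * π)⁻¹ • ∫ t in (-π)..π, ζ (polarPt ρ t)‖ₑ ^ 2 ≤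
      ∫⁻ θ in Set.Ioo (-π) π, ENNReal.ofReal ρ ^ 2 * ‖fderiv ℝ ζ (polarPt ρ θ)‖ₑ ^ 2 := by
  have hpc : Continuous (polarPt ρ) :=
    continuous_iff_continuousAt.2 fun θ => (hasDerivAt_polarPt ρ θ).continuousAt
  have hpc1 : Continuous (polarPt 1) :=
    continuous_iff_continuousAt.2 fun θ => (hasDerivAt_polarPt 1 θ).continuousAt
  have hdc : Continuous fun θ => fderiv ℝ ζ (polarPt ρ θ) :=
    (hζ.continuousOn_fderiv_of_isOpen hU le_rfl).comp_continuous hpc hmem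
  have hd : ∀ θ, HasDerivAt (fun t => ζ (polarPt ρ t))
      (fderiv ℝ ζ (polarPt ρ θ) (ρ • polarPt 1 (θ + π / 2))) θ := fun θ =>
    (((hζ.differentiableOn one_ne_zero).differentiableAt
      (hU.mem_nhds (hmem θ))).hasFDerivAt).comp_hasDerivAt θ (hasDerivAt_polarPt ρ θ)
  have hd'c : Continuous fun θ => fderiv ℝ ζ (polarPt ρ θ) (ρ • polarPt 1 (θ + π / 2)) :=
    hdc.clm_apply ((hpc1.comp (by fun_prop)).const_smul ρ)
  have hper : ζ (polarPt ρ π) = ζ (polarPt ρ (-π)) := by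
    rw [← polarPt_add_two_pi ρ (-π)]
    congr 2
    ring
  have hfc : Continuous fun t => ζ (polarPt ρ t) :=
    continuous_iff_continuousAt.2 fun x => (hd x).continuousAt
  have hW := EuclideanSpace.integral_sq_norm_sub_average_le hd hd'c hper
  set m := (2 * π)⁻¹ • ∫ t in (-π)..π, ζ (polarPt ρ t)
  have hπ : -π ≤ π := by linarith [Real.pi_pos]
  have hconv : ∀ g : ℝ → EuclideanSpace ℝ ι, Continuous g →
      ∫⁻ θ in Set.Ioo (-π) π, ‖g θ‖ₑ ^ 2 = ENNReal.ofReal (∫ θ in (-π)..π, ‖g θ‖ ^ 2) := by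
    intro g hg
    rw [intervalIntegral.integral_of_le hπ, ← restrict_Ioo_eq_restrict_Ioc,
      ofReal_integral_eq_lintegral_ofReal]
    · refine lintegral_congr fun θ => ?_
      rw [ENNReal.ofReal_pow (norm_nonneg _), ofReal_norm]
    · exact ((hg.norm.pow 2).integrableOn_Icc (a := -π) (b := π)).mono_set Set.Ioo_subset_Icc_self
    · exact ae_of_all _ fun θ => by positivity
  rw [hconv (fun θ => ζ (polarPt ρ θ) - m) (hfc.sub continuous_const)]
  refine (ENNReal.ofReal_le_ofReal hW).trans ?_
  rw [← hconv _ hd'c]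
  refine lintegral_mono fun θ => ?_
  rw [← mul_pow]
  gcongr
  refine (ContinuousLinearMap.le_opENorm _ _).trans_eq ?_
  rw [mul_comm, enorm_smul, ← ofReal_norm (polarPt 1 _), norm_polarPt zero_le_one,
    ENNReal.ofReal_one, mul_one, Real.enorm_of_nonneg hρ]

theorem aestronglyMeasurable_sub_const_smul_integral_right {E : Type*} [NormedAddCommGroup E]
    [NormedSpace ℝ E] {μ ν : Measure ℝ} [SFinite ν] {G : ℝ → ℝ → E} (c : ℝ)
    (hG : AEStronglyMeasurable (fun p : ℝ × ℝ => G p.1 p.2) (μ.prod ν)) :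
    AEStronglyMeasurable (fun p : ℝ × ℝ => G p.1 p.2 - c • ∫ t, G p.1 t ∂ν) (μ.prod ν) :=
  hG.sub (hG.integral_prod_right'.comp_fst.const_smul c)

/-- The angular mean of the radial integral `∫ ρ ζ dρ` is controlled by the oscillation of `ζ` on
circles, provided `ζ` has vanishing integral. -/
theorem lintegral_enorm_radialIntegral_le {E : Type*} [NormedAddCommGroup E] [NormedSpace ℝ E]
    [CompleteSpace E] {μ ν : Measure ℝ} [SFinite μ] [SFinite ν] {G : ℝ → ℝ → E} (c : ℝ)
    (hμ : ∀ᵐ ρ ∂μ, 0 ≤ ρ)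
    (hG : Integrable (fun p : ℝ × ℝ => p.1 • G p.1 p.2) (μ.prod ν))
    (hzero : ∫ p, p.1 • G p.1 p.2 ∂μ.prod ν = 0)
    (hGm : AEStronglyMeasurable (fun p : ℝ × ℝ => G p.1 p.2) (μ.prod ν)) :
    ∫⁻ θ, ‖∫ ρ, ρ • G ρ θ ∂μ‖ₑ ∂ν ≤
      ∫⁻ p, ENNReal.ofReal p.1 * ‖G p.1 p.2 - c • ∫ t, G p.1 t ∂ν‖ₑ ∂μ.prod ν := by
  have hm : Integrable (fun ρ => ρ • c • ∫ t, G ρ t ∂ν) μ := by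
    refine (hG.integral_prod_left.smul c).congr (ae_of_all _ fun ρ => ?_)
    simp only [Pi.smul_apply]
    rw [integral_smul, smul_comm]
  have hm0 : ∫ ρ, ρ • c • ∫ t, G ρ t ∂ν ∂μ = 0 := by
    rw [integral_prod _ hG] at hzero
    simp only [integral_smul] at hzero
    simp_rw [smul_comm _ c]
    rw [integral_smul, hzero, smul_zero]
  have hmeas : AEMeasurable (fun p : ℝ × ℝ =>
      ENNReal.ofReal p.1 * ‖G p.1 p.2 - c • ∫ t, G p.1 t ∂ν‖ₑ) (μ.prod ν) :=
    (measurable_fst.ennreal_ofReal.aemeasurable).mul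
      (aestronglyMeasurable_sub_const_smul_integral_right c hGm).enorm
  rw [lintegral_prod_symm _ hmeas]
  refine lintegral_mono_ae ?_
  filter_upwards [hG.prod_left_ae] with θ hθ
  have : ∫ ρ, ρ • G ρ θ ∂μ = ∫ ρ, ρ • (G ρ θ - c • ∫ t, G ρ t ∂ν) ∂μ := by
    simp_rw [smul_sub]
    rw [integral_sub hθ hm, hm0, sub_zero]
  rw [this]
  refine (enorm_integral_le_lintegral_enorm _).trans_eq (lintegral_congr_ae ?_)
  filter_upwards [hμ] with ρ hρ
  rw [enorm_smul, Real.enorm_of_nonneg hρ]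

theorem lintegral_mul_sq_le_of_pos {α : Type*} [MeasurableSpace α] {μ : Measure α}
    {w : α → ℝ} {g : α → ENNReal} (hw : AEMeasurable w μ) (hpos : ∀ᵐ x ∂μ, 0 < w x)
    (hg : AEMeasurable g μ) :
    (∫⁻ x, ENNReal.ofReal (w x) * g x ∂μ) ^ 2 ≤
      (∫⁻ x, ENNReal.ofReal (w x ^ 3) ∂μ) * ∫⁻ x, ENNReal.ofReal (w x)⁻¹ * g x ^ 2 ∂μ := by
  have h := ENNReal.lintegral_mul_sq_le (μ := μ) (f := fun x => ENNReal.ofReal (w x * √(w x)))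
    (g := fun x => ENNReal.ofReal (√(w x))⁻¹ * g x) (by fun_prop) (by fun_prop)
  convert h using 2
  · refine lintegral_congr_ae ?_
    filter_upwards [hpos] with x hx
    have := Real.sqrt_pos.2 hx
    rw [← mul_assoc, ← ENNReal.ofReal_mul (by positivity), mul_inv_cancel_right₀ this.ne']
  · refine lintegral_congr_ae ?_
    filter_upwards [hpos] with x hx
    rw [← ENNReal.ofReal_pow (by positivity), mul_pow, Real.sq_sqrt hx.le]
    ring_nf
  · refine lintegral_congr_ae ?_
    filter_upwards [hpos] with x hx
    rw [mul_pow, ← ENNReal.ofReal_pow (by positivity), inv_pow, Real.sq_sqrt hx.le]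

theorem lintegral_ofReal_fst_pow_three_le {R r : ℝ} (hr : r ∈ Set.Ioo 0 R) :
    ∫⁻ p, ENNReal.ofReal (p.1 ^ 3)
        ∂(volume.restrict (Set.Ioo r R)).prod (volume.restrict (Set.Ioo (-π) π)) ≤
      ENNReal.ofReal (π * R ^ 4 / 2) := by
  rw [lintegral_prod _ (by fun_prop)]
  simp only [lintegral_const, Measure.restrict_apply_univ, Real.volume_Ioo]
  rw [lintegral_mul_const _ (by fun_prop), ← ofReal_integral_eq_lintegral_ofReal,
    restrict_Ioo_eq_restrict_Ioc, ← intervalIntegral.integral_of_le hr.2.le, integral_pow,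
    ← ENNReal.ofReal_mul']
  · refine ENNReal.ofReal_le_ofReal ?_
    norm_num
    nlinarith [mul_nonneg Real.pi_pos.le (pow_nonneg hr.1.le 4)]
  · linarith [Real.pi_pos]
  · exact (continuous_pow 3).integrableOn_Icc.mono_set Set.Ioo_subset_Icc_self
  · filter_upwards [ae_restrict_mem measurableSet_Ioo] with ρ hρ
    exact pow_nonneg (hr.1.trans hρ.1).le 3

/-- The squared angular `L¹` norm of the radial integral of a function with vanishing integral is
bounded by its Dirichlet energy, as an inequality in `ℝ≥0∞`. -/
theorem ofReal_integral_norm_radialIntegral_sq_le {R r : ℝ} (hr : r ∈ Set.Ioo 0 R) {k : ℕ}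
    {ζ : EuclideanSpace ℝ (Fin 2) → EuclideanSpace ℝ (Fin k)}
    (hζ : ContDiffOn ℝ 1 ζ (annulus R r)) (hζint : IntegrableOn ζ (annulus R r))
    (hint : ∫ y in annulus R r, ζ y = 0) :
    ENNReal.ofReal (∫ θ in Set.Ioo (-π) π, ‖∫ ρ in Set.Ioo r R, ρ • ζ (polarPt ρ θ)‖) ^ 2 ≤
      ENNReal.ofReal (π * R ^ 4 / 2) *
        eLpNorm (fun y => fderiv ℝ ζ y) 2 (volume.restrict (annulus R r)) ^ 2 := by
  set μ : Measure ℝ := volume.restrict (Set.Ioo r R) with hμ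
  set ν : Measure ℝ := volume.restrict (Set.Ioo (-π) π) with hν
  have hr0 := hr.1
  have hU := isOpen_annulus R r
  have hprod : μ.prod ν = volume.restrict (Set.Ioo r R ×ˢ Set.Ioo (-π) π) := by
    rw [hμ, hν, Measure.prod_restrict, Measure.volume_eq_prod]
  have hmeasS : MeasurableSet (Set.Ioo r R ×ˢ Set.Ioo (-π) π) :=
    measurableSet_Ioo.prod measurableSet_Ioo
  have hmaps : Set.MapsTo (fun p : ℝ × ℝ => polarPt p.1 p.2) (Set.Ioo r R ×ˢ Set.Ioo (-π) π)
      (annulus R r) := fun p hp =>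
    (polarPt_mem_annulus_iff hr0 (hr0.trans hp.1.1).le _).2 hp.1
  have hGm : AEStronglyMeasurable (fun p : ℝ × ℝ => ζ (polarPt p.1 p.2)) (μ.prod ν) := by
    rw [hprod]
    exact (hζ.continuousOn.comp continuous_polarPt.continuousOn hmaps).aestronglyMeasurable hmeasS
  have hDm : AEMeasurable (fun p : ℝ × ℝ => ‖fderiv ℝ ζ (polarPt p.1 p.2)‖ₑ) (μ.prod ν) := by
    rw [hprod]
    exact (((hζ.continuousOn_fderiv_of_isOpen hU le_rfl).comp continuous_polarPt.continuousOn
      hmaps).aestronglyMeasurable hmeasS).enorm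
  have hposμ : ∀ᵐ ρ ∂μ, ρ ∈ Set.Ioo r R := ae_restrict_mem measurableSet_Ioo
  have hpos : ∀ᵐ p ∂μ.prod ν, 0 < p.1 := by
    rw [hprod]
    filter_upwards [ae_restrict_mem hmeasS] with p hp using hr0.trans hp.1.1
  have hGint : Integrable (fun p : ℝ × ℝ => p.1 • ζ (polarPt p.1 p.2)) (μ.prod ν) := by
    have hfst : AEStronglyMeasurable (fun p : ℝ × ℝ => p.1) (μ.prod ν) :=
      measurable_fst.aestronglyMeasurable
    refine ⟨hfst.smul hGm, ?_⟩
    have h := hζint.2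
    rw [hasFiniteIntegral_iff_enorm, setLIntegral_annulus hr0, ← hprod] at h
    rw [hasFiniteIntegral_iff_enorm]
    refine lt_of_eq_of_lt (lintegral_congr_ae ?_) h
    filter_upwards [hpos] with p hp
    rw [enorm_smul, Real.enorm_of_nonneg hp.le]
  have hzero : ∫ p, p.1 • ζ (polarPt p.1 p.2) ∂μ.prod ν = 0 := by
    rw [hprod, ← setIntegral_annulus hr0, hint]
  have hπ : -π ≤ π := by linarith [Real.pi_pos]
  have hosc := lintegral_enorm_radialIntegral_le
    (G := fun ρ θ => ζ (polarPt ρ θ)) (2 * π)⁻¹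
    (hposμ.mono fun ρ hρ => (hr0.trans hρ.1).le) hGint hzero hGm
  set a : ℝ × ℝ → ENNReal := fun p =>
    ‖ζ (polarPt p.1 p.2) - (2 * π)⁻¹ • ∫ t, ζ (polarPt p.1 t) ∂ν‖ₑ
  have ham : AEMeasurable a (μ.prod ν) :=
    (aestronglyMeasurable_sub_const_smul_integral_right (G := fun ρ θ => ζ (polarPt ρ θ))
      (2 * π)⁻¹ hGm).enorm
  have hCS := lintegral_mul_sq_le_of_pos (μ := μ.prod ν) (w := Prod.fst) (by fun_prop) hpos ham
  have hwirt : ∫⁻ p, ENNReal.ofReal p.1⁻¹ * a p ^ 2 ∂μ.prod ν ≤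
      ∫⁻ p, ENNReal.ofReal p.1 * ‖fderiv ℝ ζ (polarPt p.1 p.2)‖ₑ ^ 2 ∂μ.prod ν := by
    rw [lintegral_prod _ (by fun_prop), lintegral_prod _ (by fun_prop)]
    refine lintegral_mono_ae ?_
    filter_upwards [hposμ] with ρ hρ
    have hρ0 : 0 < ρ := hr0.trans hρ.1
    have h : ∫⁻ θ, a (ρ, θ) ^ 2 ∂ν ≤
        ENNReal.ofReal ρ ^ 2 * ∫⁻ θ, ‖fderiv ℝ ζ (polarPt ρ θ)‖ₑ ^ 2 ∂ν := by
      rw [← lintegral_const_mul' _ _ (by finiteness)]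
      have := lintegral_sq_enorm_sub_circleAverage_le hU hζ hρ0.le
        fun θ => (polarPt_mem_annulus_iff hr0 hρ0.le θ).2 hρ
      rwa [intervalIntegral.integral_of_le hπ, ← restrict_Ioo_eq_restrict_Ioc] at this
    rw [lintegral_const_mul' _ _ ENNReal.ofReal_ne_top,
      lintegral_const_mul' _ _ ENNReal.ofReal_ne_top]
    have hw : ENNReal.ofReal ρ⁻¹ * ENNReal.ofReal ρ ^ 2 = ENNReal.ofReal ρ := by
      rw [← ENNReal.ofReal_pow hρ0.le, ← ENNReal.ofReal_mul (by positivity)]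
      congr 1
      field_simp
    calc ENNReal.ofReal ρ⁻¹ * ∫⁻ θ, a (ρ, θ) ^ 2 ∂ν
        ≤ ENNReal.ofReal ρ⁻¹ *
          (ENNReal.ofReal ρ ^ 2 * ∫⁻ θ, ‖fderiv ℝ ζ (polarPt ρ θ)‖ₑ ^ 2 ∂ν) := by gcongr
      _ = _ := by rw [← mul_assoc, hw]
  have hnorm : ∫⁻ p, ENNReal.ofReal p.1 * ‖fderiv ℝ ζ (polarPt p.1 p.2)‖ₑ ^ 2 ∂μ.prod ν =
      eLpNorm (fun y => fderiv ℝ ζ y) 2 (volume.restrict (annulus R r)) ^ 2 := by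
    have h := eLpNorm_nnreal_pow_eq_lintegral (p := 2) (f := fun y => fderiv ℝ ζ y)
      (μ := volume.restrict (annulus R r)) two_ne_zero
    simp only [NNReal.coe_ofNat, ENNReal.rpow_two, ENNReal.coe_ofNat] at h
    rw [h, setLIntegral_annulus hr0, hprod]
  have hle : ENNReal.ofReal (∫ θ, ‖∫ ρ, ρ • ζ (polarPt ρ θ) ∂μ‖ ∂ν) ≤
      ∫⁻ θ, ‖∫ ρ, ρ • ζ (polarPt ρ θ) ∂μ‖ₑ ∂ν := by
    rw [← Real.enorm_of_nonneg (integral_nonneg fun _ => norm_nonneg _)]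
    exact (enorm_integral_le_lintegral_enorm _).trans_eq (by simp only [enorm_norm])
  calc _ ≤ (∫⁻ p, ENNReal.ofReal p.1 * a p ∂μ.prod ν) ^ 2 := by
        gcongr
        exact hle.trans hosc
    _ ≤ _ := hCS
    _ ≤ _ := mul_le_mul' (lintegral_ofReal_fst_pow_three_le hr) (hwirt.trans_eq hnorm)

/-- **Estimate on angular averages.** If `ζ : B_{R,r} → ℝ^k` is smooth with
`∫_{B_{R,r}} ζ = 0` and `‖dζ‖₂ < ∞`, then
`(∫₀^{2π} |∫_r^R ζ(ρ cos θ, ρ sin θ) ρ dρ| dθ)² ≤ (π R⁴/2) ‖dζ‖₂²`. -/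
theorem stmt9 (R r : ℝ) (hR : 0 < R) (hr : r ∈ Set.Ioo 0 R) (k : ℕ) (hk : 1 ≤ k)
    (ζ : EuclideanSpace ℝ (Fin 2) → EuclideanSpace ℝ (Fin k))
    (hζ : ContDiffOn ℝ (⊤ : ℕ∞) ζ (annulus R r))
    (hζint : IntegrableOn ζ (annulus R r))
    (hint : (∫ y in annulus R r, ζ y) = 0)
    (hfin : eLpNorm (fun y => fderiv ℝ ζ y) 2 (volume.restrict (annulus R r)) < ⊤) :
    (∫ θ in (0:ℝ)..(2 * π), ‖∫ ρ in r..R, ρ • ζ (polarPt ρ θ)‖) ^ 2 ≤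
      π * R ^ 4 / 2 *
        ((eLpNorm (fun y => fderiv ℝ ζ y) 2 (volume.restrict (annulus R r))).toReal) ^ 2 := by
  have hπ : -π ≤ π := by linarith [Real.pi_pos]
  have hshift : ∫ θ in (0:ℝ)..(2 * π), ‖∫ ρ in r..R, ρ • ζ (polarPt ρ θ)‖ =
      ∫ θ in Set.Ioo (-π) π, ‖∫ ρ in Set.Ioo r R, ρ • ζ (polarPt ρ θ)‖ := by
    have hper : Function.Periodic (fun θ => ‖∫ ρ in r..R, ρ • ζ (polarPt ρ θ)‖) (2 * π) :=
      fun θ => by simp only [polarPt_add_two_pi]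
    have := hper.intervalIntegral_add_eq 0 (-π)
    rw [zero_add, show -π + 2 * π = π by ring] at this
    rw [this, intervalIntegral.integral_of_le hπ, ← restrict_Ioo_eq_restrict_Ioc]
    simp_rw [intervalIntegral.integral_of_le hr.2.le, ← restrict_Ioo_eq_restrict_Ioc]
  have hfinal := ofReal_integral_norm_radialIntegral_sq_le hr
    (hζ.of_le (by exact_mod_cast le_top)) hζint hint
  rw [hshift]
  have hne : ENNReal.ofReal (π * R ^ 4 / 2) *
      eLpNorm (fun y => fderiv ℝ ζ y) 2 (volume.restrict (annulus R r)) ^ 2 ≠ ⊤ :=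
    ENNReal.mul_ne_top ENNReal.ofReal_ne_top (ENNReal.pow_ne_top hfin.ne)
  have := ENNReal.toReal_mono hne hfinal
  rwa [ENNReal.toReal_pow, ENNReal.toReal_ofReal (integral_nonneg fun _ => norm_nonneg _),
    ENNReal.toReal_mul, ENNReal.toReal_pow, ENNReal.toReal_ofReal (by positivity)] at this
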